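/- arXiv:2309.10084 — 7 statements merged into one kernel-verified Lean document; each statement's English description precedes it below -/
import Mathlib

section
/- Let C be a category, R a C-indexed poset, F an endofunctor of C, and F̂ a lifting of F to ∫R. Let γ : c → F c be an F-coalgebra and suppose μ_γ ∈ R(c) is a least pre-fixpoint of the monotone operator γ* ∘ F̂_c on R(c) (i.e., γ*(F̂_c(μ_γ)) ≤ μ_γ and μ_γ ≤ R for every R ∈ R(c) with γ*(F̂_c(R)) ≤ R). Then: (i) γ is a morphism (c, μ_γ) → (F c, F̂_c(μ_γ)) in ∫R; and (ii) for every F-algebra δ : F d → d, every S ∈ R(d) with F̂_d(S) ≤ δ*(S), and every morphism f : c → d in C with f = δ ∘ F f ∘ γ (a homomorphism from the coalgebra γ to the algebra δ), one has μ_γ ≤ f*(S), so f is a morphism (c, μ_γ) → (d, S) in ∫R. -/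
open CategoryTheory

universe w v u

/-- A `C`-indexed poset: a contravariant functor from `C` to posets. -/
structure IndexedPoset (C : Type u) [Category.{v} C] where
  obj : C → Type w
  po : ∀ c, PartialOrder (obj c)
  map : ∀ {c d : C}, (c ⟶ d) → obj d → obj c
  map_mono : ∀ {c d : C} (f : c ⟶ d), Monotone (map f)
  map_id : ∀ (c : C) (S : obj c), map (𝟙 c) S = S
  map_comp : ∀ {c d e : C} (f : c ⟶ d) (g : d ⟶ e) (S : obj e),
    map (f ≫ g) S = map f (map g S)

attribute [instance] IndexedPoset.po

variable {C : Type u} [Category.{v} C]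

/-- The Grothendieck category `∫R` of a `C`-indexed poset `R`. -/
structure Groth (R : IndexedPoset C) where
  base : C
  fib : R.obj base

instance Groth.category (R : IndexedPoset C) : Category (Groth R) where
  Hom X Y := { f : X.base ⟶ Y.base // X.fib ≤ R.map f Y.fib }
  id X := ⟨𝟙 X.base, (R.map_id X.base X.fib).ge⟩
  comp {X Y Z} f g := ⟨f.val ≫ g.val, by
    rw [R.map_comp]
    exact le_trans f.property (R.map_mono f.val g.property)⟩
  id_comp f := by apply Subtype.ext; simp
  comp_id f := by apply Subtype.ext; simp
  assoc f g h := by apply Subtype.ext; simp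

/-- The forgetful functor `U : ∫R ⥤ C`. -/
def grothForget (R : IndexedPoset C) : Groth R ⥤ C where
  obj X := X.base
  map f := f.val

theorem Groth.eq_mk {R : IndexedPoset C} (X : Groth R) {b : C} (h : X.base = b) :
    X = ⟨b, cast (congrArg R.obj h) X.fib⟩ := by
  cases X
  cases h
  rfl

/-- Given an endofunctor `F̂` of `∫R` lifting `F : C ⥤ C` (i.e. `U ∘ F̂ = F ∘ U`),
the induced fibre map `F̂_c : R(c) → R(F c)`. -/
def liftObj (R : IndexedPoset C) {F : C ⥤ C} (Fhat : Groth R ⥤ Groth R)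
    (H : Fhat ⋙ grothForget R = grothForget R ⋙ F) {c : C} (Rc : R.obj c) :
    R.obj (F.obj c) :=
  cast (congrArg R.obj (Functor.congr_obj H ⟨c, Rc⟩)) (Fhat.obj ⟨c, Rc⟩).fib

theorem Groth.cast_fib_le_map_cast_fib {R : IndexedPoset C} {X Y : Groth R} (g : X ⟶ Y)
    {a b : C} (hX : X.base = a) (hY : Y.base = b) (h : a ⟶ b)
    (hg : g.val = eqToHom hX ≫ h ≫ eqToHom hY.symm) :
    cast (congrArg R.obj hX) X.fib ≤ R.map h (cast (congrArg R.obj hY) Y.fib) := by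
  subst hX hY
  have hgh : g.val = h := by simpa using hg
  simpa [hgh] using g.property

theorem liftObj_le_map_liftObj {R : IndexedPoset C} {F : C ⥤ C} (Fhat : Groth R ⥤ Groth R)
    (H : Fhat ⋙ grothForget R = grothForget R ⋙ F) {c d : C} (f : c ⟶ d)
    {A : R.obj c} {B : R.obj d} (hf : A ≤ R.map f B) :
    liftObj R Fhat H A ≤ R.map (F.map f) (liftObj R Fhat H B) :=
  let φ : (⟨c, A⟩ : Groth R) ⟶ ⟨d, B⟩ := ⟨f, hf⟩
  Groth.cast_fib_le_map_cast_fib (Fhat.map φ) (Functor.congr_obj H _) (Functor.congr_obj H _)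
    (F.map f) (Functor.congr_hom H φ)

theorem liftObj_monotone {R : IndexedPoset C} {F : C ⥤ C} (Fhat : Groth R ⥤ Groth R)
    (H : Fhat ⋙ grothForget R = grothForget R ⋙ F) {c : C} :
    Monotone (fun A : R.obj c => liftObj R Fhat H A) := by
  intro A B hAB
  simpa [R.map_id] using
    liftObj_le_map_liftObj Fhat H (𝟙 c) (hAB.trans (R.map_id c B).ge)

/-- Lemma 2.7 (initial-algebra key lemma): if `μγ` is a least pre-fixpoint of
`γ* ∘ F̂_c`, then (i) `γ` lifts to a coalgebra `(c,μγ) ⟶ (F c, F̂_c μγ)`, and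
(ii) every homomorphism `f` from the coalgebra `γ` to an algebra `δ` with a
lifting `S` satisfies `μγ ≤ f*(S)`, i.e. lifts to `(c,μγ) ⟶ (d,S)`. -/
theorem least_prefixpoint_lifting (R : IndexedPoset C) (F : C ⥤ C)
    (Fhat : Groth R ⥤ Groth R)
    (H : Fhat ⋙ grothForget R = grothForget R ⋙ F)
    {c : C} (γ : c ⟶ F.obj c) (μγ : R.obj c)
    (hpre : R.map γ (liftObj R Fhat H μγ) ≤ μγ)
    (hleast : ∀ Rc : R.obj c, R.map γ (liftObj R Fhat H Rc) ≤ Rc → μγ ≤ Rc) :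
    μγ ≤ R.map γ (liftObj R Fhat H μγ) ∧
    ∀ (d : C) (δ : F.obj d ⟶ d) (S : R.obj d),
      liftObj R Fhat H S ≤ R.map δ S →
      ∀ f : c ⟶ d, f = γ ≫ F.map f ≫ δ → μγ ≤ R.map f S := by
  refine ⟨hleast _ (R.map_mono γ (liftObj_monotone Fhat H hpre)), ?_⟩
  intro d δ S hS f hf
  apply hleast
  calc R.map γ (liftObj R Fhat H (R.map f S))
      ≤ R.map γ (R.map (F.map f) (liftObj R Fhat H S)) :=
        R.map_mono γ (liftObj_le_map_liftObj Fhat H f le_rfl)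
    _ ≤ R.map γ (R.map (F.map f) (R.map δ S)) :=
        R.map_mono γ (R.map_mono (F.map f) hS)
    _ = R.map f S := by rw [← R.map_comp (F.map f), ← R.map_comp γ, ← hf]
end

section
/- Let C be a category, R a C-indexed poset, F an endofunctor of C, and F̂ a lifting of F to ∫R. Let α : F a → a be an initial F-algebra (so α is invertible by Lambek's lemma). If the monotone operator (α⁻¹)* ∘ F̂_a on R(a) has a least pre-fixpoint μ_α, then α : (F a, F̂_a(μ_α)) → (a, μ_α) is an initial F̂-algebra in ∫R. -/
open CategoryTheory

universe w v u

variable {C : Type u} [Category.{v} C]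

namespace Groth

variable {R : IndexedPoset C}

theorem hom_ext {X Y : Groth R} {f g : X ⟶ Y} (h : f.val = g.val) : f = g :=
  Subtype.ext h

theorem comp_val {X Y Z : Groth R} (f : X ⟶ Y) (g : Y ⟶ Z) :
    (f ≫ g).val = f.val ≫ g.val :=
  rfl

theorem eqToHom_val {X Y : Groth R} (h : X = Y) :
    (eqToHom h).val = eqToHom (congrArg Groth.base h) := by
  cases h
  rfl

variable {F : C ⥤ C} {Fhat : Groth R ⥤ Groth R}

theorem base_obj (H : Fhat ⋙ grothForget R = grothForget R ⋙ F) (X : Groth R) :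
    (Fhat.obj X).base = F.obj X.base :=
  Functor.congr_obj H X

theorem map_val (H : Fhat ⋙ grothForget R = grothForget R ⋙ F) {X Y : Groth R}
    (f : X ⟶ Y) :
    (Fhat.map f).val =
      eqToHom (base_obj H X) ≫ F.map f.val ≫ eqToHom (base_obj H Y).symm :=
  Functor.congr_hom H f

/-- The canonical isomorphism from `F̂ X` to its description by `F` and `liftObj`. -/
def liftIso (H : Fhat ⋙ grothForget R = grothForget R ⋙ F) (X : Groth R) :
    Fhat.obj X ≅ ⟨F.obj X.base, liftObj R Fhat H X.fib⟩ :=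
  eqToIso (eq_mk (Fhat.obj X) (base_obj H X))

theorem liftIso_hom_val (H : Fhat ⋙ grothForget R = grothForget R ⋙ F) (X : Groth R) :
    (liftIso H X).hom.val = eqToHom (base_obj H X) :=
  eqToHom_val (eq_mk (Fhat.obj X) (base_obj H X))

theorem liftIso_inv_val (H : Fhat ⋙ grothForget R = grothForget R ⋙ F) (X : Groth R) :
    (liftIso H X).inv.val = eqToHom (base_obj H X).symm :=
  eqToHom_val (eq_mk (Fhat.obj X) (base_obj H X)).symm

/-- The structure map of the `F`-algebra underlying an `F̂`-algebra. -/
def baseStr (H : Fhat ⋙ grothForget R = grothForget R ⋙ F)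
    (B : Endofunctor.Algebra Fhat) : F.obj B.a.base ⟶ B.a.base :=
  ((liftIso H B.a).inv ≫ B.str).val

theorem baseStr_eq (H : Fhat ⋙ grothForget R = grothForget R ⋙ F)
    (B : Endofunctor.Algebra Fhat) :
    baseStr H B = eqToHom (base_obj H B.a).symm ≫ B.str.val :=
  congrArg (· ≫ B.str.val) (liftIso_inv_val H B.a)

/-- A morphism of `∫R` is an `F̂`-algebra homomorphism exactly when its underlying morphism is
an `F`-algebra homomorphism. -/
theorem algebra_comm_iff (H : Fhat ⋙ grothForget R = grothForget R ⋙ F)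
    {B D : Endofunctor.Algebra Fhat} (f : B.a ⟶ D.a) :
    Fhat.map f ≫ D.str = B.str ≫ f ↔ F.map f.val ≫ baseStr H D = baseStr H B ≫ f.val := by
  have key : (Fhat.map f ≫ D.str).val =
      eqToHom (base_obj H B.a) ≫ F.map f.val ≫ baseStr H D := by
    rw [comp_val, map_val H, baseStr_eq]
    simp only [Category.assoc]
  have key' : (B.str ≫ f).val = eqToHom (base_obj H B.a) ≫ baseStr H B ≫ f.val := by
    rw [comp_val, baseStr_eq]
    simp only [Category.assoc, eqToHom_trans_assoc, eqToHom_refl, Category.id_comp]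
  constructor
  · intro h
    exact (cancel_epi (eqToHom (base_obj H B.a))).1
      (key.symm.trans ((congrArg Subtype.val h).trans key'))
  · intro h
    exact hom_ext (key.trans ((congrArg (eqToHom (base_obj H B.a) ≫ ·) h).trans key'.symm))

/-- A lifting acts on fibres laxly naturally with respect to reindexing. -/
theorem liftObj_le (H : Fhat ⋙ grothForget R = grothForget R ⋙ F) {X Y : Groth R}
    (f : X ⟶ Y) :
    liftObj R Fhat H X.fib ≤ R.map (F.map f.val) (liftObj R Fhat H Y.fib) := by
  have h := ((liftIso H X).inv ≫ Fhat.map f ≫ (liftIso H Y).hom).property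
  have e : ((liftIso H X).inv ≫ Fhat.map f ≫ (liftIso H Y).hom).val = F.map f.val := by
    rw [comp_val, comp_val, map_val H, liftIso_inv_val, liftIso_hom_val]
    simp only [Category.assoc, eqToHom_trans, eqToHom_trans_assoc, eqToHom_refl,
      Category.id_comp]
    exact Category.comp_id _
  rwa [e] at h

/-- Reindexing along an `F`-algebra homomorphism into an `F̂`-algebra yields a pre-fixpoint. -/
theorem map_hom_isPrefixpoint (H : Fhat ⋙ grothForget R = grothForget R ⋙ F)
    {A : Endofunctor.Algebra F} [IsIso A.str] (B : Endofunctor.Algebra Fhat)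
    (h : A.a ⟶ B.a.base) (comm : F.map h ≫ baseStr H B = A.str ≫ h) :
    R.map (inv A.str) (liftObj R Fhat H (R.map h B.a.fib)) ≤ R.map h B.a.fib := by
  let f : (⟨A.a, R.map h B.a.fib⟩ : Groth R) ⟶ B.a := ⟨h, le_rfl⟩
  have h₁ : liftObj R Fhat H (R.map h B.a.fib) ≤
      R.map (F.map h) (R.map (baseStr H B) B.a.fib) :=
    (liftObj_le H f).trans
      (R.map_mono _ ((liftIso H B.a).inv ≫ B.str).property)
  refine (R.map_mono (inv A.str) h₁).trans (le_of_eq ?_)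
  rw [← R.map_comp (F.map h), comm, ← R.map_comp, IsIso.inv_hom_id_assoc]

end Groth

/-- Initial-algebra lifting theorem: if `α : F a ⟶ a` is an initial `F`-algebra
(whose structure map is invertible by Lambek's lemma) and the monotone operator
`(α⁻¹)* ∘ F̂_a` on `R(a)` has a least pre-fixpoint `μ`, then
`α : (F a, F̂_a μ) ⟶ (a, μ)` is an initial `F̂`-algebra in `∫R`. -/
theorem initial_algebra_lifting (R : IndexedPoset C) (F : C ⥤ C)
    (Fhat : Groth R ⥤ Groth R)
    (H : Fhat ⋙ grothForget R = grothForget R ⋙ F)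
    (A : Endofunctor.Algebra F) (hA : Limits.IsInitial A)
    (μ : R.obj A.a)
    (hpre : R.map (@inv _ _ _ _ A.str (Endofunctor.Algebra.Initial.str_isIso hA))
      (liftObj R Fhat H μ) ≤ μ)
    (hleast : ∀ x : R.obj A.a,
      R.map (@inv _ _ _ _ A.str (Endofunctor.Algebra.Initial.str_isIso hA))
        (liftObj R Fhat H x) ≤ x → μ ≤ x) :
    Nonempty (Limits.IsInitial
      (⟨⟨A.a, μ⟩,
        eqToHom (Groth.eq_mk (Fhat.obj ⟨A.a, μ⟩) (Functor.congr_obj H ⟨A.a, μ⟩)) ≫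
        (⟨A.str, by
          haveI := Endofunctor.Algebra.Initial.str_isIso hA
          have h2 := R.map_mono A.str hpre
          rwa [← R.map_comp, IsIso.hom_inv_id, R.map_id] at h2⟩ :
          (⟨F.obj A.a, liftObj R Fhat H μ⟩ : Groth R) ⟶ (⟨A.a, μ⟩ : Groth R))⟩ :
        Endofunctor.Algebra Fhat)) := by
  have := Endofunctor.Algebra.Initial.str_isIso hA
  generalize_proofs p₁ p₂ p₃
  let M : Endofunctor.Algebra Fhat :=
    ⟨⟨A.a, μ⟩, (Groth.liftIso H ⟨A.a, μ⟩).hom ≫ ⟨A.str, p₃⟩⟩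
  have hM : Groth.baseStr H M = A.str :=
    congrArg Subtype.val ((Groth.liftIso H ⟨A.a, μ⟩).inv_hom_id_assoc
      (⟨A.str, p₃⟩ : (⟨F.obj A.a, liftObj R Fhat H μ⟩ : Groth R) ⟶ ⟨A.a, μ⟩))
  let base (B : Endofunctor.Algebra Fhat) : Endofunctor.Algebra F :=
    ⟨B.a.base, Groth.baseStr H B⟩
  have comm_iff {B : Endofunctor.Algebra Fhat} (f : M.a ⟶ B.a) :
      Fhat.map f ≫ B.str = M.str ≫ f ↔
        F.map f.val ≫ Groth.baseStr H B = A.str ≫ f.val := by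
    rw [← hM]
    exact Groth.algebra_comm_iff H f
  exact ⟨Limits.IsInitial.ofUniqueHom (X := M)
    (fun B => ⟨⟨(hA.to (base B)).f,
      hleast _ (Groth.map_hom_isPrefixpoint H B _ (hA.to (base B)).h)⟩,
      (comm_iff _).2 (hA.to (base B)).h⟩)
    fun B m => Endofunctor.Algebra.Hom.ext (Groth.hom_ext
      (congrArg Endofunctor.Algebra.Hom.f
        (hA.hom_ext (⟨m.f.val, (comm_iff m.f).1 m.h⟩ : A ⟶ base B) (hA.to (base B)))))⟩
end

section
/- Let C be a category and R a C-indexed ipo, i.e., a C-indexed poset such that every fiber R(c) has a least element and suprema of all directed subsets. Let F be an endofunctor of C and F̂ a lifting of F to ∫R. Then every initial F-algebra α : F a → a lifts to an initial F̂-algebra: there exists μ ∈ R(a) such that α : (F a, F̂_a(μ)) → (a, μ) is an initial F̂-algebra in ∫R. -/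
open CategoryTheory

universe w v u

variable {C : Type u} [Category.{v} C]

/-- A monotone endofunction of an inductive poset has a least pre-fixpoint. -/
theorem Monotone.exists_least_prefixpoint {P : Type*} [PartialOrder P]
    (hbot : ∃ b : P, ∀ x : P, b ≤ x)
    (hdir : ∀ S : Set P, DirectedOn (· ≤ ·) S → ∃ l, IsLUB S l)
    {f : P → P} (hf : Monotone f) :
    ∃ m, f m ≤ m ∧ ∀ x, f x ≤ x → m ≤ x := by
  obtain ⟨b, hb⟩ := hbot
  obtain ⟨m, -, hm⟩ := zorn_le_nonempty₀ {x | x ≤ f x ∧ ∀ y, f y ≤ y → x ≤ y}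
    (fun c hc hchain _ _ => by
      obtain ⟨l, hl⟩ := hdir c hchain.directedOn
      refine ⟨l, ⟨hl.2 fun x hx => ?_, fun y hy => hl.2 fun x hx => (hc hx).2 y hy⟩, hl.1⟩
      exact (hc hx).1.trans (hf (hl.1 hx)))
    b ⟨hb _, fun y _ => hb y⟩
  exact ⟨m, hm.2 ⟨hf hm.prop.1, fun y hy => (hf (hm.prop.2 y hy)).trans hy⟩ hm.prop.1, hm.prop.2⟩

theorem Groth.comp_val_s6 {R : IndexedPoset C} {X Y Z : Groth R} (f : X ⟶ Y) (g : Y ⟶ Z) :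
    (f ≫ g).val = f.val ≫ g.val :=
  rfl

theorem Groth.eqToHom_val_s6 {R : IndexedPoset C} {X Y : Groth R} (h : X = Y) :
    (eqToHom h).val = eqToHom (congrArg Groth.base h) := by
  cases h
  rfl

section

variable {R : IndexedPoset C} {F : C ⥤ C} {Fhat : Groth R ⥤ Groth R}

theorem lifting_base (H : Fhat ⋙ grothForget R = grothForget R ⋙ F) (X : Groth R) :
    (Fhat.obj X).base = F.obj X.base :=
  Functor.congr_obj H X

theorem lifting_map_val (H : Fhat ⋙ grothForget R = grothForget R ⋙ F)
    {X Y : Groth R} (f : X ⟶ Y) :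
    (Fhat.map f).val = eqToHom (lifting_base H X) ≫ F.map f.val ≫
      eqToHom (lifting_base H Y).symm :=
  Functor.congr_hom H f

variable (H : Fhat ⋙ grothForget R = grothForget R ⋙ F)

theorem lifting_obj_eq (X : Groth R) :
    Fhat.obj X = ⟨F.obj X.base, liftObj R Fhat H X.fib⟩ :=
  Groth.eq_mk (Fhat.obj X) (lifting_base H X)

theorem liftObj_le_map {X Y : Groth R} (g : Fhat.obj X ⟶ Y) :
    liftObj R Fhat H X.fib ≤ R.map (eqToHom (lifting_base H X).symm ≫ g.val) Y.fib := by
  have h := (eqToHom (lifting_obj_eq H X).symm ≫ g).property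
  rwa [Groth.comp_val_s6, Groth.eqToHom_val_s6] at h

theorem liftObj_le_map_liftObj_s6 {X Y : Groth R} (f : X ⟶ Y) :
    liftObj R Fhat H X.fib ≤ R.map (F.map f.val) (liftObj R Fhat H Y.fib) := by
  have h := liftObj_le_map H (Fhat.map f ≫ eqToHom (lifting_obj_eq H Y))
  rw [Groth.comp_val_s6, lifting_map_val H, Groth.eqToHom_val_s6] at h
  simpa using h

theorem liftObj_mono {c : C} : Monotone (liftObj R Fhat H (c := c)) := by
  intro S T hST
  let i : (⟨c, S⟩ : Groth R) ⟶ ⟨c, T⟩ := ⟨𝟙 c, hST.trans (R.map_id c T).ge⟩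
  have h : _ ≤ R.map (F.map (𝟙 c)) (liftObj R Fhat H T) := liftObj_le_map_liftObj_s6 H i
  rwa [F.map_id, R.map_id] at h

/-- The `F`-algebra underlying an algebra for a lifting of `F`. -/
def baseAlgebra (B : Endofunctor.Algebra Fhat) : Endofunctor.Algebra F where
  a := B.a.base
  str := eqToHom (lifting_base H B.a).symm ≫ B.str.val

theorem map_comp_str_val {X : Groth R} (B : Endofunctor.Algebra Fhat) (f : X ⟶ B.a) :
    (Fhat.map f ≫ B.str).val =
      eqToHom (lifting_base H X) ≫ F.map f.val ≫ (baseAlgebra H B).str := by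
  rw [Groth.comp_val_s6, lifting_map_val H]
  simp only [Category.assoc]
  rfl

theorem eqToHom_comp_val {X Y : Groth R} (f : F.obj X.base ⟶ Y.base)
    (h : liftObj R Fhat H X.fib ≤ R.map f Y.fib) (Z : Groth R) (g : Y ⟶ Z) :
    ((eqToHom (lifting_obj_eq H X) ≫
      (⟨f, h⟩ : (⟨F.obj X.base, liftObj R Fhat H X.fib⟩ : Groth R) ⟶ Y)) ≫ g).val =
      eqToHom (lifting_base H X) ≫ f ≫ g.val := by
  rw [Groth.comp_val_s6, Groth.comp_val_s6, Groth.eqToHom_val_s6, Category.assoc]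

end

/-- Corollary: if `R` is a `C`-indexed ipo (every fibre has a least element and
joins of directed subsets), then every initial `F`-algebra lifts to an initial
`F̂`-algebra along the relational fibration. -/
theorem initial_algebra_lifting_ipo (R : IndexedPoset C)
    (hbot : ∀ c : C, ∃ b : R.obj c, ∀ x : R.obj c, b ≤ x)
    (hdir : ∀ (c : C) (S : Set (R.obj c)), DirectedOn (· ≤ ·) S → ∃ l, IsLUB S l)
    (F : C ⥤ C) (Fhat : Groth R ⥤ Groth R)
    (H : Fhat ⋙ grothForget R = grothForget R ⋙ F)
    (A : Endofunctor.Algebra F) (hA : Limits.IsInitial A) :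
    ∃ (μ : R.obj A.a) (h : liftObj R Fhat H μ ≤ R.map A.str μ),
      Nonempty (Limits.IsInitial
        (⟨⟨A.a, μ⟩,
          eqToHom (Groth.eq_mk (Fhat.obj ⟨A.a, μ⟩) (Functor.congr_obj H ⟨A.a, μ⟩)) ≫
          (⟨A.str, h⟩ :
            (⟨F.obj A.a, liftObj R Fhat H μ⟩ : Groth R) ⟶ (⟨A.a, μ⟩ : Groth R))⟩ :
          Endofunctor.Algebra Fhat)) := by
  have hiso : IsIso A.str := Endofunctor.Algebra.Initial.str_isIso hA
  obtain ⟨μ, hμ, hleast⟩ := Monotone.exists_least_prefixpoint (hbot A.a) (hdir A.a)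
    ((R.map_mono (inv A.str)).comp (liftObj_mono H))
  have hstr : liftObj R Fhat H μ ≤ R.map A.str μ := by
    have h := R.map_mono A.str hμ
    rwa [Function.comp_apply, ← R.map_comp, IsIso.hom_inv_id, R.map_id] at h
  refine ⟨μ, hstr, ⟨Limits.IsInitial.ofUniqueHom (fun B => ?_) ?_⟩⟩
  · let f : A ⟶ baseAlgebra H B := hA.to (baseAlgebra H B)
    have hpre : μ ≤ R.map f.f B.a.fib := by
      apply hleast
      have hF := liftObj_le_map_liftObj_s6 H (X := ⟨A.a, R.map f.f B.a.fib⟩) (Y := B.a)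
        ⟨f.f, le_rfl⟩
      have hB := hF.trans (R.map_mono _ (liftObj_le_map H B.str))
      rw [← R.map_comp] at hB
      have hA' : _ ≤ R.map (A.str ≫ f.f) B.a.fib := f.h ▸ hB
      have hle := (R.map_mono (inv A.str) hA').trans (R.map_comp _ _ _).ge
      rwa [IsIso.inv_hom_id_assoc] at hle
    refine ⟨⟨f.f, hpre⟩, Subtype.ext ?_⟩
    refine (map_comp_str_val H B _).trans (.trans ?_
      (eqToHom_comp_val H (X := ⟨A.a, μ⟩) (Y := ⟨A.a, μ⟩) A.str hstr B.a _).symm)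
    exact congrArg (eqToHom _ ≫ ·) f.h
  · intro B g
    have hg := (map_comp_str_val H B g.f).symm.trans
      ((congrArg Subtype.val g.h).trans
        (eqToHom_comp_val H (X := ⟨A.a, μ⟩) (Y := ⟨A.a, μ⟩) A.str hstr B.a g.f))
    let g₀ : A ⟶ baseAlgebra H B := ⟨g.f.val, (cancel_epi _).1 hg⟩
    exact Endofunctor.Algebra.Hom.ext
      (Subtype.ext (congrArg Endofunctor.Algebra.Hom.f (hA.hom_ext g₀ (hA.to _))))
end

section
/- Let C be a category and R a C-indexed poset with existential quantification, i.e., for every morphism f : c → d of C the monotone map f* : R(d) → R(c) has a left adjoint ∃_f : R(c) → R(d). Let F be an endofunctor of C and F̂ a lifting of F to ∫R. Let δ : d → F d be an F-coalgebra and suppose ν_δ ∈ R(d) is a greatest post-fixpoint of the monotone operator δ* ∘ F̂_d on R(d) (i.e., ν_δ ≤ δ*(F̂_d(ν_δ)) and S ≤ ν_δ for every S ∈ R(d) with S ≤ δ*(F̂_d(S))). Then: (i) δ is a morphism (d, ν_δ) → (F d, F̂_d(ν_δ)) in ∫R; and (ii) for every F-coalgebra γ : c → F c, every R ∈ R(c)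 with R ≤ γ*(F̂_c(R)), and every morphism f : c → d in C with δ ∘ f = F f ∘ γ (a coalgebra homomorphism from γ to δ), one has R ≤ f*(ν_δ), so f is a morphism (c, R) → (d, ν_δ) in ∫R. -/
open CategoryTheory

universe w v u

variable {C : Type u} [Category.{v} C]

/-- A morphism of `∫R` still witnesses an inequality of fibre elements after transport along
equalities of the base objects. -/
theorem Groth.cast_fib_le {R : IndexedPoset C} {X Y : Groth R} (g : X ⟶ Y) {a b : C}
    (hX : X.base = a) (hY : Y.base = b) (h : a ⟶ b)
    (hg : (grothForget R).map g = eqToHom hX ≫ h ≫ eqToHom hY.symm) :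
    cast (congrArg R.obj hX) X.fib ≤ R.map h (cast (congrArg R.obj hY) Y.fib) := by
  subst hX hY
  have hgh : g.val = h := by
    simpa [grothForget] using hg
  subst hgh
  exact g.property

/-- A lifting sends an inequality over `f` to an inequality over `F f`. -/
theorem liftObj_le_map_s7 (R : IndexedPoset C) {F : C ⥤ C} (Fhat : Groth R ⥤ Groth R)
    (H : Fhat ⋙ grothForget R = grothForget R ⋙ F) {c d : C} (f : c ⟶ d)
    {x : R.obj c} {y : R.obj d} (hxy : x ≤ R.map f y) :
    liftObj R Fhat H x ≤ R.map (F.map f) (liftObj R Fhat H y) := by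
  let g : (⟨c, x⟩ : Groth R) ⟶ ⟨d, y⟩ := ⟨f, hxy⟩
  exact Groth.cast_fib_le (Fhat.map g) (Functor.congr_obj H ⟨c, x⟩)
    (Functor.congr_obj H ⟨d, y⟩) (F.map f) (Functor.congr_hom H g)

/-- Lemma (final-coalgebra key lemma): for `R` with existential quantification,
if `νδ` is a greatest post-fixpoint of `δ* ∘ F̂_d`, then (i) `δ` lifts to a
morphism `(d,νδ) ⟶ (F d, F̂_d νδ)`, and (ii) every coalgebra homomorphism `f`
from a lifted coalgebra `(γ, R)` to `δ` satisfies `R ≤ f*(νδ)`. -/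
theorem greatest_postfixpoint_lifting (R : IndexedPoset C)
    (hex : ∀ {c d : C} (f : c ⟶ d), ∃ E : R.obj c → R.obj d,
      ∀ (x : R.obj c) (y : R.obj d), E x ≤ y ↔ x ≤ R.map f y)
    (F : C ⥤ C) (Fhat : Groth R ⥤ Groth R)
    (H : Fhat ⋙ grothForget R = grothForget R ⋙ F)
    {d : C} (δ : d ⟶ F.obj d) (νδ : R.obj d)
    (hpost : νδ ≤ R.map δ (liftObj R Fhat H νδ))
    (hgreatest : ∀ S : R.obj d, S ≤ R.map δ (liftObj R Fhat H S) → S ≤ νδ) :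
    νδ ≤ R.map δ (liftObj R Fhat H νδ) ∧
    ∀ (c : C) (γ : c ⟶ F.obj c) (Rc : R.obj c),
      Rc ≤ R.map γ (liftObj R Fhat H Rc) →
      ∀ f : c ⟶ d, f ≫ δ = γ ≫ F.map f → Rc ≤ R.map f νδ := by
  refine ⟨hpost, fun c γ Rc hγ f hf => ?_⟩
  obtain ⟨E, hE⟩ := hex f
  have hunit : Rc ≤ R.map f (E Rc) := (hE Rc (E Rc)).mp le_rfl
  refine (hE Rc νδ).mp (hgreatest (E Rc) ((hE _ _).mpr ?_))
  rw [← R.map_comp, hf, R.map_comp]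
  exact hγ.trans (R.map_mono γ (liftObj_le_map_s7 R Fhat H f hunit))
end

section
/- Let C be a category with objects s, t and a pole ⊥ ⊆ C(s,t). For every morphism f : c → d of C, the inverse image along post-composition with f preserves double orthogonal closedness: if Y ⊆ C(s,d) satisfies Y = Y^⊥⊥, then the subset (f∘-)⁻¹(Y) = {x : s → c | f ∘ x ∈ Y} of C(s,c) satisfies (f∘-)⁻¹(Y) = ((f∘-)⁻¹(Y))^⊥⊥. -/
open CategoryTheory

universe v u

variable {C : Type u} [Category.{v} C]

/-- Orthogonal of a set `X ⊆ C(s,c)` of "terms" with respect to a pole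
`P ⊆ C(s,t)`: the set of `u : c ⟶ t` with `u ∘ x ∈ P` for all `x ∈ X`. -/
def orthT (s t : C) (P : Set (s ⟶ t)) {c : C} (X : Set (s ⟶ c)) : Set (c ⟶ t) :=
  {u | ∀ x ∈ X, x ≫ u ∈ P}

/-- Orthogonal of a set `U ⊆ C(c,t)` of "contexts" with respect to a pole
`P ⊆ C(s,t)`: the set of `x : s ⟶ c` with `u ∘ x ∈ P` for all `u ∈ U`. -/
def orthS (s t : C) (P : Set (s ⟶ t)) {c : C} (U : Set (c ⟶ t)) : Set (s ⟶ c) :=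
  {x | ∀ u ∈ U, x ≫ u ∈ P}

/-- Inverse image along post-composition preserves double orthogonal
closedness: if `Y = Y^⊥⊥` then `(f∘-)⁻¹(Y) = ((f∘-)⁻¹(Y))^⊥⊥`. -/
theorem preimage_biorth_closed (s t : C) (P : Set (s ⟶ t)) {c d : C}
    (f : c ⟶ d) (Y : Set (s ⟶ d))
    (hY : Y = orthS s t P (orthT s t P Y)) :
    {x : s ⟶ c | x ≫ f ∈ Y} =
      orthS s t P (orthT s t P {x : s ⟶ c | x ≫ f ∈ Y}) := by
  refine Set.Subset.antisymm (fun x hx u hu => hu x hx) fun x hx => ?_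
  rw [Set.mem_ofPred_eq, hY]
  intro v hv
  rw [Category.assoc]
  refine hx (f ≫ v) fun z hz => ?_
  rw [← Category.assoc]
  exact hv (z ≫ f) hz
end

section
/- Let C be a category with objects s, t and a pole ⊥ ⊆ C(s,t). The assignment c ↦ D(c) with reindexing D(f) := (f∘-)⁻¹ : D(d) → D(c) for f : c → d defines a C-indexed poset D (a functor C^op → Poset with all fibers complete lattices), and there is an isomorphism of categories between the Grothendieck category ∫D and the focused orthogonality category O_⊥(C) which commutes with the forgetful functors to C. -/
open CategoryTheory

universe w v u

variable {C : Type u} [Category.{v} C]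

/-- The focused orthogonality category `O_⊥(C)`: objects are pairs `(c, X)`
with `X ⊆ C(s,c)` double orthogonally closed; morphisms `(c,X) ⟶ (d,Y)` are
morphisms `f : c ⟶ d` of `C` with `f ∘ x ∈ Y` for all `x ∈ X`. -/
structure OrthCat (s t : C) (P : Set (s ⟶ t)) where
  base : C
  pred : Set (s ⟶ base)
  closed : pred = orthS s t P (orthT s t P pred)

instance OrthCat.category (s t : C) (P : Set (s ⟶ t)) :
    Category (OrthCat s t P) where
  Hom X Y := { f : X.base ⟶ Y.base // ∀ x ∈ X.pred, x ≫ f ∈ Y.pred }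
  id X := ⟨𝟙 X.base, fun x hx => by simpa using hx⟩
  comp {X Y Z} f g := ⟨f.val ≫ g.val, fun x hx => by
    rw [← Category.assoc]
    exact g.property _ (f.property x hx)⟩
  id_comp f := by apply Subtype.ext; simp
  comp_id f := by apply Subtype.ext; simp
  assoc f g h := by apply Subtype.ext; simp

/-- The forgetful functor `O_⊥(C) ⥤ C`. -/
def orthForget (s t : C) (P : Set (s ⟶ t)) : OrthCat s t P ⥤ C where
  obj X := X.base
  map f := f.val

theorem preimage_closed (s t : C) (P : Set (s ⟶ t)) {c d : C} (f : c ⟶ d)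
    (Y : Set (s ⟶ d)) (hY : Y = orthS s t P (orthT s t P Y)) :
    {x : s ⟶ c | x ≫ f ∈ Y} =
      orthS s t P (orthT s t P {x : s ⟶ c | x ≫ f ∈ Y}) := by
  apply Set.Subset.antisymm
  · intro x hx u hu
    exact hu x hx
  · intro z hz
    show z ≫ f ∈ Y
    rw [hY]
    intro v hv
    rw [Category.assoc]
    exact hz (f ≫ v) (fun q hq => by rw [← Category.assoc]; exact hv (q ≫ f) hq)

/-- The `C`-indexed poset `D` of double orthogonally closed subsets:
`D(c) = {X ⊆ C(s,c) | X = X^⊥⊥}` ordered by inclusion, with reindexing along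
`f : c ⟶ d` given by inverse image under post-composition with `f`. -/
def orthIndexed (s t : C) (P : Set (s ⟶ t)) : IndexedPoset C where
  obj c := {X : Set (s ⟶ c) // X = orthS s t P (orthT s t P X)}
  po c := inferInstance
  map {c d} f Y :=
    ⟨{x : s ⟶ c | x ≫ f ∈ Y.val}, preimage_closed s t P f Y.val Y.property⟩
  map_mono {c d} f := fun Y Y' h x hx => h hx
  map_id c Y := by apply Subtype.ext; ext x; simp
  map_comp {c d e} f g Y := by apply Subtype.ext; ext x; simp [Category.assoc]

theorem subset_orthS_orthT (s t : C) (P : Set (s ⟶ t)) {c : C} (X : Set (s ⟶ c)) :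
    X ⊆ orthS s t P (orthT s t P X) :=
  fun x hx _ hu => hu x hx

theorem orthS_orthT_mono (s t : C) (P : Set (s ⟶ t)) {c : C} {X Y : Set (s ⟶ c)}
    (h : X ⊆ Y) : orthS s t P (orthT s t P X) ⊆ orthS s t P (orthT s t P Y) :=
  fun _ hx u hu => hx u fun y hy => hu y (h hy)

/-- Every set of the form `U^⊥` is double orthogonally closed. -/
theorem orthS_closed (s t : C) (P : Set (s ⟶ t)) {c : C} (U : Set (c ⟶ t)) :
    orthS s t P U = orthS s t P (orthT s t P (orthS s t P U)) :=
  (subset_orthS_orthT s t P _).antisymm fun _ hx u hu => hx u fun _ hy => hy u hu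

theorem sInter_closed (s t : C) (P : Set (s ⟶ t)) {c : C} (T : Set (Set (s ⟶ c)))
    (hT : ∀ X ∈ T, X = orthS s t P (orthT s t P X)) :
    ⋂₀ T = orthS s t P (orthT s t P (⋂₀ T)) :=
  (subset_orthS_orthT s t P _).antisymm fun x hx X hX => by
    rw [hT X hX]
    exact orthS_orthT_mono s t P (Set.sInter_subset_of_mem hX) hx

theorem orthIndexed_exists_isGLB (s t : C) (P : Set (s ⟶ t)) (c : C)
    (T : Set ((orthIndexed s t P).obj c)) : ∃ g, IsGLB T g := by
  refine ⟨⟨⋂₀ (Subtype.val '' T), sInter_closed s t P _ ?_⟩, ?_, ?_⟩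
  · rintro _ ⟨X, -, rfl⟩
    exact X.property
  · intro X hX x hx
    exact hx X.val ⟨X, hX, rfl⟩
  · rintro Y hY x hx _ ⟨X, hX, rfl⟩
    exact hY hX hx

theorem orthIndexed_exists_isLUB (s t : C) (P : Set (s ⟶ t)) (c : C)
    (T : Set ((orthIndexed s t P).obj c)) : ∃ l, IsLUB T l := by
  refine ⟨⟨orthS s t P (orthT s t P (⋃₀ (Subtype.val '' T))), orthS_closed s t P _⟩, ?_, ?_⟩
  · intro X hX x hx
    exact subset_orthS_orthT s t P _ ⟨X.val, ⟨X, hX, rfl⟩, hx⟩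
  · intro Y hY x hx
    rw [Y.property]
    refine orthS_orthT_mono s t P ?_ hx
    rintro y ⟨_, ⟨X, hX, rfl⟩, hy⟩
    exact hY hX hy

/-- The comparison functor `∫D ⥤ O_⊥(C)`. -/
def grothToOrthCat (s t : C) (P : Set (s ⟶ t)) :
    Groth (orthIndexed s t P) ⥤ OrthCat s t P where
  obj X := ⟨X.base, X.fib.val, X.fib.property⟩
  map f := ⟨f.val, fun _ hx => f.property hx⟩

/-- The comparison functor `O_⊥(C) ⥤ ∫D`. -/
def orthCatToGroth (s t : C) (P : Set (s ⟶ t)) :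
    OrthCat s t P ⥤ Groth (orthIndexed s t P) where
  obj X := ⟨X.base, ⟨X.pred, X.closed⟩⟩
  map f := ⟨f.val, fun x hx => f.property x hx⟩

/-- The Grothendieck category of the `C`-indexed poset (with complete lattice
fibres) of double orthogonally closed subsets is isomorphic to the focused
orthogonality category `O_⊥(C)`, compatibly with the forgetful functors
to `C`. -/
theorem groth_iso_orthCat (s t : C) (P : Set (s ⟶ t)) :
    (∀ (c : C) (T : Set ((orthIndexed s t P).obj c)),
      (∃ g, IsGLB T g) ∧ (∃ l, IsLUB T l)) ∧
    ∃ (G : Groth (orthIndexed s t P) ⥤ OrthCat s t P)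
      (G' : OrthCat s t P ⥤ Groth (orthIndexed s t P)),
      G ⋙ G' = 𝟭 _ ∧ G' ⋙ G = 𝟭 _ ∧
      G ⋙ orthForget s t P = grothForget (orthIndexed s t P) ∧
      G' ⋙ grothForget (orthIndexed s t P) = orthForget s t P := by
  exact ⟨fun c T => ⟨orthIndexed_exists_isGLB s t P c T, orthIndexed_exists_isLUB s t P c T⟩,
    grothToOrthCat s t P, orthCatToGroth s t P, rfl, rfl, rfl, rfl⟩
end

section
/- Let C be a category with objects s, t and a pole ⊥ ⊆ C(s,t), let F be an endofunctor of C, and let F̂ be an endofunctor of the focused orthogonality category O_⊥(C) that is a lifting of F (i.e., U ∘ F̂ = F ∘ U for U : O_⊥(C) → C the forgetful functor). Then F has an initial algebra if and only if F̂ has an initial algebra, and F has a final coalgebra if and only if F̂ has a final coalgebra. -/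
open CategoryTheory

universe v u

variable {C : Type u} [Category.{v} C]

namespace OrthCat

variable {s t : C} {P : Set (s ⟶ t)}

lemma orthS_closed {c : C} (V : Set (c ⟶ t)) :
    orthS s t P V = orthS s t P (orthT s t P (orthS s t P V)) :=
  Set.Subset.antisymm (fun _ hx _ hu => hu _ hx) (fun _ hx v hv => hx v fun _ hy => hy v hv)

lemma mem_of_forall_orthT {c : C} {X : Set (s ⟶ c)} (hX : X = orthS s t P (orthT s t P X))
    {x : s ⟶ c} (hx : ∀ u ∈ orthT s t P X, x ≫ u ∈ P) : x ∈ X := by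
  rw [hX]
  exact hx

lemma comp_mem_of_mem_biorth {c d : C} {X : Set (s ⟶ c)} {Y : Set (s ⟶ d)}
    (hY : Y = orthS s t P (orthT s t P Y)) (f : c ⟶ d) (h : ∀ x ∈ X, x ≫ f ∈ Y)
    {x : s ⟶ c} (hx : x ∈ orthS s t P (orthT s t P X)) : x ≫ f ∈ Y := by
  refine mem_of_forall_orthT hY fun u hu => ?_
  rw [Category.assoc]
  refine hx (f ≫ u) fun y hy => ?_
  rw [← Category.assoc]
  exact hu _ (h y hy)

lemma preimage_closed {c d : C} {Y : Set (s ⟶ d)} (hY : Y = orthS s t P (orthT s t P Y))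
    (f : c ⟶ d) :
    {x : s ⟶ c | x ≫ f ∈ Y} = orthS s t P (orthT s t P {x : s ⟶ c | x ≫ f ∈ Y}) :=
  Set.Subset.antisymm (fun _ hx _ hu => hu _ hx)
    (fun _ hx => comp_mem_of_mem_biorth hY f (fun _ hy => hy) hx)

lemma univ_closed (c : C) :
    (Set.univ : Set (s ⟶ c)) = orthS s t P (orthT s t P Set.univ) :=
  Set.Subset.antisymm (fun _ hx _ hu => hu _ hx) (Set.subset_univ _)

section Lifting

variable {F : C ⥤ C} {G : OrthCat s t P ⥤ OrthCat s t P}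
  (α : G ⋙ orthForget s t P ≅ orthForget s t P ⋙ F)

/-- The comparison from the carrier of a lifted object to the image of its carrier. -/
def toBase (A : OrthCat s t P) : (G.obj A).base ⟶ F.obj A.base :=
  α.hom.app A

/-- The comparison from the image of a carrier to the carrier of the lifted object. -/
def ofBase (A : OrthCat s t P) : F.obj A.base ⟶ (G.obj A).base :=
  α.inv.app A

@[simp]
lemma toBase_ofBase (A : OrthCat s t P) : toBase α A ≫ ofBase α A = 𝟙 _ :=
  α.hom_inv_id_app A

@[simp]
lemma ofBase_toBase (A : OrthCat s t P) : ofBase α A ≫ toBase α A = 𝟙 _ :=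
  α.inv_hom_id_app A

lemma toBase_ofBase_assoc (A : OrthCat s t P) {c : C} (f : (G.obj A).base ⟶ c) :
    toBase α A ≫ ofBase α A ≫ f = f := by
  rw [← Category.assoc, toBase_ofBase, Category.id_comp]

lemma ofBase_toBase_assoc (A : OrthCat s t P) {c : C} (f : F.obj A.base ⟶ c) :
    ofBase α A ≫ toBase α A ≫ f = f := by
  rw [← Category.assoc, ofBase_toBase, Category.id_comp]

lemma toBase_naturality {A B : OrthCat s t P} (f : A ⟶ B) :
    (G.map f).val ≫ toBase α B = toBase α A ≫ F.map f.val :=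
  α.hom.naturality f

lemma ofBase_naturality {A B : OrthCat s t P} (f : A ⟶ B) :
    F.map f.val ≫ ofBase α B = ofBase α A ≫ (G.map f).val :=
  α.inv.naturality f

lemma ofBase_naturality_assoc {A B : OrthCat s t P} (f : A ⟶ B) {c : C}
    (g : (G.obj B).base ⟶ c) :
    F.map f.val ≫ ofBase α B ≫ g = ofBase α A ≫ (G.map f).val ≫ g := by
  rw [← Category.assoc, ofBase_naturality, Category.assoc]

/-- The algebra underlying an algebra of a lifted endofunctor. -/
abbrev algebraBase (A : Endofunctor.Algebra G) : Endofunctor.Algebra F :=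
  ⟨A.a.base, ofBase α A.a ≫ A.str.val⟩

/-- The coalgebra underlying a coalgebra of a lifted endofunctor. -/
abbrev coalgebraBase (A : Endofunctor.Coalgebra G) : Endofunctor.Coalgebra F :=
  ⟨A.V.base, A.str.val ≫ toBase α A.V⟩

lemma algebra_square_iff {A B : OrthCat s t P} (a : G.obj A ⟶ A) (b : G.obj B ⟶ B) (f : A ⟶ B) :
    G.map f ≫ b = a ≫ f ↔
      F.map f.val ≫ ofBase α B ≫ b.val = (ofBase α A ≫ a.val) ≫ f.val := by
  rw [ofBase_naturality_assoc, Category.assoc]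
  refine ⟨fun h => congrArg (ofBase α A ≫ ·) (congrArg Subtype.val h), fun h => ?_⟩
  have h' := congrArg (toBase α A ≫ ·) h
  simp only [toBase_ofBase_assoc] at h'
  exact Subtype.ext h'

lemma coalgebra_square_iff {A B : OrthCat s t P} (a : A ⟶ G.obj A) (b : B ⟶ G.obj B)
    (f : A ⟶ B) :
    a ≫ G.map f = f ≫ b ↔
      (a.val ≫ toBase α A) ≫ F.map f.val = f.val ≫ b.val ≫ toBase α B := by
  rw [Category.assoc, ← toBase_naturality]
  refine ⟨fun h => ?_, fun h => ?_⟩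
  · have h' := congrArg (· ≫ toBase α B) (congrArg Subtype.val h)
    exact (Category.assoc _ _ _).symm.trans (h'.trans (Category.assoc _ _ _))
  · have h' := congrArg (· ≫ ofBase α B) h
    simp only [Category.assoc, toBase_ofBase, Category.comp_id] at h'
    exact Subtype.ext h'

/-- The underlying algebra morphism of a morphism of algebras of a lifted endofunctor. -/
def algebraHomBase {A B : Endofunctor.Algebra G} (f : A ⟶ B) :
    algebraBase α A ⟶ algebraBase α B :=
  ⟨f.f.val, (algebra_square_iff α A.str B.str f.f).1 f.h⟩

/-- The underlying coalgebra morphism of a morphism of coalgebras of a lifted endofunctor. -/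
def coalgebraHomBase {A B : Endofunctor.Coalgebra G} (f : A ⟶ B) :
    coalgebraBase α A ⟶ coalgebraBase α B :=
  ⟨f.f.val, (coalgebra_square_iff α A.str B.str f.f).1 f.h⟩

/-- An algebra morphism that preserves predicates, as a morphism of algebras of a lifted
endofunctor. -/
def algebraHomLift {A B : Endofunctor.Algebra G} (f : algebraBase α A ⟶ algebraBase α B)
    (hf : ∀ x ∈ A.a.pred, x ≫ f.f ∈ B.a.pred) : A ⟶ B :=
  ⟨⟨f.f, hf⟩, (algebra_square_iff α A.str B.str ⟨f.f, hf⟩).2 f.h⟩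

/-- A coalgebra morphism that preserves predicates, as a morphism of coalgebras of a lifted
endofunctor. -/
def coalgebraHomLift {A B : Endofunctor.Coalgebra G} (f : coalgebraBase α A ⟶ coalgebraBase α B)
    (hf : ∀ x ∈ A.V.pred, x ≫ f.f ∈ B.V.pred) : A ⟶ B :=
  ⟨⟨f.f, hf⟩, (coalgebra_square_iff α A.str B.str ⟨f.f, hf⟩).2 f.h⟩

/-- A closed predicate on the carrier of an algebra is inductive if the structure map lifts. -/
def IsInductive (A : Endofunctor.Algebra F) (X : Set (s ⟶ A.a))
    (hX : X = orthS s t P (orthT s t P X)) : Prop :=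
  ∀ x ∈ (G.obj ⟨A.a, X, hX⟩).pred, x ≫ toBase α ⟨A.a, X, hX⟩ ≫ A.str ∈ X

/-- A closed predicate on the carrier of a coalgebra is coinductive if the structure map lifts. -/
def IsCoinductive (A : Endofunctor.Coalgebra F) (X : Set (s ⟶ A.V))
    (hX : X = orthS s t P (orthT s t P X)) : Prop :=
  ∀ x ∈ X, x ≫ A.str ≫ ofBase α ⟨A.V, X, hX⟩ ∈ (G.obj ⟨A.V, X, hX⟩).pred

/-- The algebra of a lifted endofunctor given by an inductive predicate. -/
def algebraLift (A : Endofunctor.Algebra F) (X : Set (s ⟶ A.a))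
    (hX : X = orthS s t P (orthT s t P X)) (h : IsInductive α A X hX) :
    Endofunctor.Algebra G :=
  ⟨⟨A.a, X, hX⟩, ⟨toBase α ⟨A.a, X, hX⟩ ≫ A.str, h⟩⟩

/-- The coalgebra of a lifted endofunctor given by a coinductive predicate. -/
def coalgebraLift (A : Endofunctor.Coalgebra F) (X : Set (s ⟶ A.V))
    (hX : X = orthS s t P (orthT s t P X)) (h : IsCoinductive α A X hX) :
    Endofunctor.Coalgebra G :=
  ⟨⟨A.V, X, hX⟩, ⟨A.str ≫ ofBase α ⟨A.V, X, hX⟩, h⟩⟩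

lemma algebraBase_algebraLift (A : Endofunctor.Algebra F) (X : Set (s ⟶ A.a))
    (hX : X = orthS s t P (orthT s t P X)) (h : IsInductive α A X hX) :
    algebraBase α (algebraLift α A X hX h) = A :=
  congrArg (Endofunctor.Algebra.mk A.a) (ofBase_toBase_assoc α ⟨A.a, X, hX⟩ A.str)

lemma coalgebraBase_coalgebraLift (A : Endofunctor.Coalgebra F) (X : Set (s ⟶ A.V))
    (hX : X = orthS s t P (orthT s t P X)) (h : IsCoinductive α A X hX) :
    coalgebraBase α (coalgebraLift α A X hX h) = A :=
  congrArg (Endofunctor.Coalgebra.mk A.V) <|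
    (Category.assoc _ _ _).trans <|
      (congrArg (A.str ≫ ·) (ofBase_toBase α ⟨A.V, X, hX⟩)).trans (Category.comp_id _)

lemma isInductive_preimage (A : Endofunctor.Algebra F) (B : Endofunctor.Algebra G)
    (f : A.a ⟶ B.a.base) (h : F.map f ≫ (algebraBase α B).str = A.str ≫ f) :
    IsInductive α A {x | x ≫ f ∈ B.a.pred} (preimage_closed B.a.closed f) := by
  intro x hx
  let g : (⟨A.a, _, preimage_closed B.a.closed f⟩ : OrthCat s t P) ⟶ B.a := ⟨f, fun _ h => h⟩
  have n := ofBase_naturality_assoc α g B.str.val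
  have k : toBase α _ ≫ A.str ≫ f = (G.map g).val ≫ B.str.val := by
    rw [← h]
    exact (congrArg (toBase α _ ≫ ·) n).trans (toBase_ofBase_assoc α _ _)
  change (x ≫ toBase α _ ≫ A.str) ≫ f ∈ B.a.pred
  rw [Category.assoc, Category.assoc, k, ← Category.assoc]
  exact B.str.property _ ((G.map g).property x hx)

lemma isCoinductive_image (A : Endofunctor.Coalgebra F) (B : Endofunctor.Coalgebra G)
    (f : B.V.base ⟶ A.V) (h : (coalgebraBase α B).str ≫ F.map f = f ≫ A.str) :
    IsCoinductive α A (orthS s t P (orthT s t P ((· ≫ f) '' B.V.pred))) (orthS_closed _) := by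
  intro y hy
  refine comp_mem_of_mem_biorth (G.obj _).closed _ ?_ hy
  rintro _ ⟨x, hx, rfl⟩
  let g : B.V ⟶ (⟨A.V, _, orthS_closed (orthT s t P ((· ≫ f) '' B.V.pred))⟩ : OrthCat s t P) :=
    ⟨f, fun x hx _ hu => hu _ ⟨x, hx, rfl⟩⟩
  have n := ofBase_naturality α g
  have k : f ≫ A.str ≫ ofBase α ⟨A.V, _, orthS_closed _⟩ = B.str.val ≫ (G.map g).val := by
    rw [← Category.assoc, ← h, Category.assoc, Category.assoc]
    exact congrArg (B.str.val ≫ ·) <|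
      (congrArg (toBase α _ ≫ ·) n).trans (toBase_ofBase_assoc α _ _)
  dsimp only
  rw [Category.assoc, k, ← Category.assoc]
  exact (G.map g).property _ (B.str.property x hx)

lemma exists_map_comp_toBase_of_subset {c : C} {X Y : Set (s ⟶ c)} (hX : X = orthS s t P (orthT s t P X))
    (hY : Y = orthS s t P (orthT s t P Y)) (h : X ⊆ Y) :
    ∃ i : G.obj ⟨c, X, hX⟩ ⟶ G.obj ⟨c, Y, hY⟩,
      i.val ≫ toBase α ⟨c, Y, hY⟩ = toBase α ⟨c, X, hX⟩ := by
  let j : (⟨c, X, hX⟩ : OrthCat s t P) ⟶ ⟨c, Y, hY⟩ := ⟨𝟙 c, fun x hx => by simpa using h hx⟩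
  refine ⟨G.map j, (toBase_naturality α j).trans ?_⟩
  exact (congrArg (toBase α _ ≫ ·) (F.map_id c)).trans (Category.comp_id _)

lemma exists_least_isInductive (A : Endofunctor.Algebra F) :
    ∃ X hX, IsInductive α A X hX ∧ ∀ Y hY, IsInductive α A Y hY → X ⊆ Y := by
  let V : Set (A.a ⟶ t) := {u | ∃ Y hY, IsInductive α A Y hY ∧ u ∈ orthT s t P Y}
  have hV : ∀ Y hY, IsInductive α A Y hY → orthS s t P V ⊆ Y := fun Y hY h x hx =>
    mem_of_forall_orthT hY fun u hu => hx u ⟨Y, hY, h, hu⟩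
  refine ⟨orthS s t P V, orthS_closed V, ?_, hV⟩
  rintro x hx u ⟨Y, hY, h, hu⟩
  obtain ⟨i, hi⟩ := exists_map_comp_toBase_of_subset α (orthS_closed V) hY (hV Y hY h)
  have e := hu _ (h _ (i.property x hx))
  rwa [Category.assoc x, ← Category.assoc i.val, hi] at e

lemma exists_greatest_isCoinductive (A : Endofunctor.Coalgebra F) :
    ∃ X hX, IsCoinductive α A X hX ∧ ∀ Y hY, IsCoinductive α A Y hY → Y ⊆ X := by
  let W : Set (s ⟶ A.V) := {x | ∃ Y hY, IsCoinductive α A Y hY ∧ x ∈ Y}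
  have hW : ∀ Y hY, IsCoinductive α A Y hY → Y ⊆ orthS s t P (orthT s t P W) :=
    fun Y hY h x hx _ hu => hu x ⟨Y, hY, h, hx⟩
  refine ⟨_, orthS_closed (orthT s t P W), fun x hx => ?_, hW⟩
  refine comp_mem_of_mem_biorth (G.obj _).closed _ ?_ hx
  rintro y ⟨Y, hY, h, hy⟩
  obtain ⟨i, hi⟩ := exists_map_comp_toBase_of_subset α hY (orthS_closed (orthT s t P W)) (hW Y hY h)
  have e := i.property _ (h y hy)
  have k : ofBase α ⟨A.V, Y, hY⟩ ≫ i.val = ofBase α ⟨A.V, _, orthS_closed (orthT s t P W)⟩ := by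
    have := congrArg (fun f => ofBase α ⟨A.V, Y, hY⟩ ≫ f ≫ ofBase α ⟨A.V, _, orthS_closed _⟩) hi
    simpa only [Category.assoc, toBase_ofBase, ofBase_toBase_assoc, Category.comp_id] using this
  rw [Category.assoc, Category.assoc, k] at e
  exact e

lemma exists_algebraBase_eq (A : Endofunctor.Algebra F) :
    ∃ B : Endofunctor.Algebra G, algebraBase α B = A ∧ ∀ x, x ∈ B.a.pred :=
  ⟨algebraLift α A Set.univ (univ_closed A.a) fun _ _ => trivial,
    algebraBase_algebraLift α A _ _ _, fun _ => trivial⟩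

lemma exists_coalgebraBase_eq (A : Endofunctor.Coalgebra F) :
    ∃ B : Endofunctor.Coalgebra G, coalgebraBase α B = A ∧
      B.V.pred = orthS s t P (orthT s t P ∅) :=
  ⟨coalgebraLift α A _ (orthS_closed (orthT s t P ∅)) fun _ hx =>
      comp_mem_of_mem_biorth (G.obj _).closed _ (fun _ hy => hy.elim) hx,
    coalgebraBase_coalgebraLift α A _ _ _, rfl⟩

lemma exists_isInitial_lift (α : G ⋙ orthForget s t P ≅ orthForget s t P ⋙ F)
    {A : Endofunctor.Algebra F} (hA : Limits.IsInitial A) :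
    ∃ B : Endofunctor.Algebra G, Nonempty (Limits.IsInitial B) := by
  obtain ⟨X, hX, h, hmin⟩ := exists_least_isInductive α A
  have hA' : Limits.IsInitial (algebraBase α (algebraLift α A X hX h)) :=
    hA.ofIso (eqToIso (algebraBase_algebraLift α A X hX h).symm)
  refine ⟨algebraLift α A X hX h, ⟨Limits.IsInitial.ofUniqueHom
    (fun B => algebraHomLift α (hA'.to (algebraBase α B)) ?_)
    fun B m => Endofunctor.Algebra.ext (Subtype.ext (congrArg Endofunctor.Algebra.Hom.f
      (hA'.hom_ext (algebraHomBase α m) (hA'.to _))))⟩⟩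
  refine hmin _ _ (isInductive_preimage α A B _ ((hA'.to (algebraBase α B)).h.trans ?_))
  exact congrArg (· ≫ (hA'.to (algebraBase α B)).f) (ofBase_toBase_assoc α ⟨A.a, X, hX⟩ A.str)

lemma exists_isTerminal_lift (α : G ⋙ orthForget s t P ≅ orthForget s t P ⋙ F)
    {A : Endofunctor.Coalgebra F} (hA : Limits.IsTerminal A) :
    ∃ B : Endofunctor.Coalgebra G, Nonempty (Limits.IsTerminal B) := by
  obtain ⟨X, hX, h, hmax⟩ := exists_greatest_isCoinductive α A
  have e := coalgebraBase_coalgebraLift α A X hX h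
  have hA' : Limits.IsTerminal (coalgebraBase α (coalgebraLift α A X hX h)) :=
    hA.ofIso (eqToIso e.symm)
  refine ⟨coalgebraLift α A X hX h, ⟨Limits.IsTerminal.ofUniqueHom
    (fun B => coalgebraHomLift α (hA'.from (coalgebraBase α B)) ?_)
    fun B m => Endofunctor.Coalgebra.ext (Subtype.ext (congrArg Endofunctor.Coalgebra.Hom.f
      (hA'.hom_ext (coalgebraHomBase α m) (hA'.from _))))⟩⟩
  intro x hx
  refine hmax _ _ (isCoinductive_image α A B (hA'.from (coalgebraBase α B)).f
    ((hA'.from (coalgebraBase α B)).h.trans ?_)) fun _ hu => hu _ ⟨x, hx, rfl⟩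
  refine congrArg ((hA'.from (coalgebraBase α B)).f ≫ ·) ?_
  exact (Category.assoc _ _ _).trans <|
    (congrArg (A.str ≫ ·) (ofBase_toBase α ⟨A.V, X, hX⟩)).trans (Category.comp_id _)

lemma nonempty_isInitial_algebraBase {A : Endofunctor.Algebra G} (hA : Limits.IsInitial A) :
    Nonempty (Limits.IsInitial (algebraBase α A)) := by
  have key : ∀ D, Nonempty (Unique (algebraBase α A ⟶ D)) := by
    intro D
    obtain ⟨B, rfl, hB⟩ := exists_algebraBase_eq α D
    refine ⟨⟨⟨algebraHomBase α (hA.to B)⟩, fun m => ?_⟩⟩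
    exact congrArg (algebraHomBase α)
      (hA.hom_ext (algebraHomLift α m fun _ _ => hB _) (hA.to B))
  have := fun D => (key D).some
  exact ⟨Limits.IsInitial.ofUnique _⟩

lemma nonempty_isTerminal_coalgebraBase {A : Endofunctor.Coalgebra G}
    (hA : Limits.IsTerminal A) : Nonempty (Limits.IsTerminal (coalgebraBase α A)) := by
  have key : ∀ D, Nonempty (Unique (D ⟶ coalgebraBase α A)) := by
    intro D
    obtain ⟨B, rfl, hB⟩ := exists_coalgebraBase_eq α D
    refine ⟨⟨⟨coalgebraHomBase α (hA.from B)⟩, fun m => ?_⟩⟩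
    exact congrArg (coalgebraHomBase α) (hA.hom_ext (coalgebraHomLift α m fun x hx =>
      comp_mem_of_mem_biorth A.V.closed _ (fun _ hy => hy.elim) (hB ▸ hx)) (hA.from B))
  have := fun D => (key D).some
  exact ⟨Limits.IsTerminal.ofUnique _⟩

end Lifting

end OrthCat

/-- For a lifting `F̂` of `F` to the focused orthogonality category, `F` has an
initial algebra iff `F̂` does, and `F` has a final coalgebra iff `F̂` does. -/
theorem orth_lifting_initial_final (s t : C) (P : Set (s ⟶ t))
    (F : C ⥤ C) (Fhat : OrthCat s t P ⥤ OrthCat s t P)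
    (H : Fhat ⋙ orthForget s t P = orthForget s t P ⋙ F) :
    ((∃ A : Endofunctor.Algebra F, Nonempty (Limits.IsInitial A)) ↔
      (∃ Ahat : Endofunctor.Algebra Fhat, Nonempty (Limits.IsInitial Ahat))) ∧
    ((∃ B : Endofunctor.Coalgebra F, Nonempty (Limits.IsTerminal B)) ↔
      (∃ Bhat : Endofunctor.Coalgebra Fhat, Nonempty (Limits.IsTerminal Bhat))) := by
  have α := eqToIso H
  exact ⟨⟨fun ⟨_, ⟨h⟩⟩ => OrthCat.exists_isInitial_lift α h,
      fun ⟨_, ⟨h⟩⟩ => ⟨_, OrthCat.nonempty_isInitial_algebraBase α h⟩⟩,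
    ⟨fun ⟨_, ⟨h⟩⟩ => OrthCat.exists_isTerminal_lift α h,
      fun ⟨_, ⟨h⟩⟩ => ⟨_, OrthCat.nonempty_isTerminal_coalgebraBase α h⟩⟩⟩
end
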